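/- arXiv:2605.20789 — 6 statements merged into one kernel-verified Lean document; each statement's English description precedes it below -/
import Mathlib

section
/- Let G be a finite connected simple graph on n vertices with n ≥ 2. Then G has a 1-covering walk of length at most 2n − 3. -/
/-- A walk `p` in a simple graph `G` is a *1-covering walk* if every vertex of `G` either
lies on `p` (belongs to its support) or is adjacent in `G` to some vertex lying on `p`. -/
def SimpleGraph.Walk.IsOneCovering {V : Type*} (G : SimpleGraph V) {u v : V}
    (p : G.Walk u v) : Prop :=
  ∀ w : V, w ∈ p.support ∨ ∃ x ∈ p.support, G.Adj w x

theorem closed_walk_aux {V : Type*} [Fintype V] [DecidableEq V] (G : SimpleGraph V)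
    (hG : G.Connected) (k : ℕ) (hk : k + 1 ≤ Fintype.card V) :
    ∃ (u : V) (p : G.Walk u u), p.support.toFinset.card = k + 1 ∧ p.length ≤ 2 * k := by
  induction k with
  | zero =>
    obtain ⟨u⟩ := hG.nonempty
    exact ⟨u, SimpleGraph.Walk.nil, by simp, by simp⟩
  | succ k ih =>
    obtain ⟨u, p, hc, hl⟩ := ih (by omega)
    obtain ⟨w, hw⟩ : ∃ w, w ∉ p.support.toFinset := by
      by_contra! h
      have : p.support.toFinset = Finset.univ := Finset.eq_univ_iff_forall.2 h
      rw [this, Finset.card_univ] at hc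
      omega
    obtain ⟨q⟩ := hG.preconnected u w
    obtain ⟨d, -, hx, hy⟩ := q.exists_boundary_dart (p.support.toFinset : Set V)
      (by simp) (by simpa using hw)
    obtain ⟨⟨x, y⟩, hxy⟩ := d
    have hx : x ∈ p.support := by simpa using hx
    have hy : y ∉ p.support := by simpa using hy
    have hxy : G.Adj x y := hxy
    refine ⟨u, (p.takeUntil x hx).append
      (SimpleGraph.Walk.cons hxy (SimpleGraph.Walk.cons hxy.symm (p.dropUntil x hx))), ?_, ?_⟩
    · rw [← hc, ← Finset.card_insert_of_notMem (a := y) (by simpa using hy)]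
      congr 1
      ext z
      have h1 : z ∈ p.support ↔ z ∈ (p.takeUntil x hx).support ∨ z ∈ (p.dropUntil x hx).support := by
        rw [← SimpleGraph.Walk.mem_support_append_iff, SimpleGraph.Walk.take_spec]
      have h2 : x ∈ (p.dropUntil x hx).support := SimpleGraph.Walk.start_mem_support _
      simp only [List.mem_toFinset, SimpleGraph.Walk.mem_support_append_iff,
        SimpleGraph.Walk.support_cons, List.mem_cons, Finset.mem_insert, h1]
      grind
    · have := congrArg SimpleGraph.Walk.length (p.take_spec hx)
      simp only [SimpleGraph.Walk.length_append, SimpleGraph.Walk.length_cons] at this ⊢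
      omega

/-- A finite connected simple graph on `n ≥ 2` vertices has a 1-covering walk of length
at most `2n - 3`. -/
theorem one_covering_walk_length_le {V : Type*} [Fintype V] (G : SimpleGraph V)
    (hG : G.Connected) (hn : 2 ≤ Fintype.card V) :
    ∃ (u v : V) (p : G.Walk u v),
      p.IsOneCovering G ∧ p.length ≤ 2 * Fintype.card V - 3 := by
  classical
  obtain ⟨u, p, hc, hl⟩ := closed_walk_aux G hG (Fintype.card V - 2) (by omega)
  refine ⟨u, u, p, ?_, by omega⟩
  intro w
  by_cases hw : w ∈ p.support
  · exact Or.inl hw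
  right
  obtain ⟨q⟩ := hG.preconnected u w
  obtain ⟨d, -, hx, hy⟩ := q.exists_boundary_dart (p.support.toFinset : Set V)
    (by simp) (by simpa using hw)
  obtain ⟨⟨x, y⟩, hxy⟩ := d
  have hx : x ∈ p.support := by simpa using hx
  have hy : y ∉ p.support := by simpa using hy
  have hxy : G.Adj x y := hxy
  have hwy : w = y := by
    by_contra hne
    have h1 : (insert w (insert y p.support.toFinset)).card = Fintype.card V - 2 + 1 + 1 + 1 := by
      rw [Finset.card_insert_of_notMem (by simp [hne, hw]),
        Finset.card_insert_of_notMem (by simpa using hy), hc]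
    have h2 := Finset.card_le_univ (insert w (insert y p.support.toFinset))
    omega
  exact ⟨x, hx, hwy ▸ hxy.symm⟩
end

section
/- Let T be a tree with n ≥ 3 vertices and with exactly ℒ leaves. Then T has a closed 1-covering walk whose support is contained in the set of internal vertices of T and whose length is at most 2(n − ℒ − 1). -/
theorem aux_path_degree {V : Type*} [Fintype V] [DecidableEq V]
    (G : SimpleGraph V) [DecidableRel G.Adj] {u w : V} (p : G.Walk u w) (hp : p.IsPath)
    (hu : 2 ≤ G.degree u) : ∀ x ∈ p.support, x ≠ w → 2 ≤ G.degree x := by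
  induction p with
  | nil =>
    intro x hx hne
    simp at hx
    exact absurd hx hne
  | @cons a b c h q ih =>
    intro x hx hne
    rw [SimpleGraph.Walk.cons_isPath_iff] at hp
    rw [SimpleGraph.Walk.support_cons, List.mem_cons] at hx
    rcases hx with rfl | hx
    · exact hu
    · refine ih hp.1 ?_ x hx hne
      cases q with
      | nil =>
        simp at hx
        exact absurd hx hne
      | @cons _ d _ h' q' =>
        have had : a ≠ d := by
          rintro rfl
          apply hp.2
          simp
        have hsub : ({a, d} : Finset V) ⊆ G.neighborFinset b := by
          intro z hz
          simp only [Finset.mem_insert, Finset.mem_singleton] at hz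
          rw [SimpleGraph.mem_neighborFinset]
          rcases hz with rfl | rfl
          · exact h.symm
          · exact h'
        have := Finset.card_le_card hsub
        rw [Finset.card_pair had] at this
        simpa using this

theorem aux_grow {V : Type*} [Fintype V] [DecidableEq V]
    (G : SimpleGraph V) [DecidableRel G.Adj] (hc : G.Connected) (v : V) (hv : 2 ≤ G.degree v)
    (k : ℕ) : ∃ p : G.Walk v v, (∀ u ∈ p.support, 2 ≤ G.degree u) ∧
      p.length + 2 ≤ 2 * p.support.toFinset.card ∧
      ((∀ w, 2 ≤ G.degree w → w ∈ p.support) ∨ k ≤ p.support.toFinset.card) := by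
  induction k with
  | zero =>
    exact ⟨SimpleGraph.Walk.nil, by simpa using hv, by simp, Or.inr (Nat.zero_le _)⟩
  | succ k ih =>
    obtain ⟨p, h1, h2, h3⟩ := ih
    by_cases hall : ∀ w, 2 ≤ G.degree w → w ∈ p.support
    · exact ⟨p, h1, h2, Or.inl hall⟩
    have h3 := h3.resolve_left hall
    push Not at hall
    obtain ⟨w, hw, hwp⟩ := hall
    obtain ⟨q, hq⟩ := hc.exists_isPath v w
    obtain ⟨d, hd, hx, hy⟩ := q.exists_boundary_dart {x | x ∈ p.support} (by simp) hwp
    simp only [Set.mem_setOf_eq] at hx hy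
    have hdy : 2 ≤ G.degree d.snd := by
      by_cases e : d.snd = w
      · rw [e]; exact hw
      · exact aux_path_degree G q hq hv _ (q.dart_snd_mem_support_of_mem_darts hd) e
    let r : G.Walk v v := (p.takeUntil _ hx).append
      (SimpleGraph.Walk.cons d.adj (SimpleGraph.Walk.cons d.adj.symm (p.dropUntil _ hx)))
    have hlen : r.length = p.length + 2 := by
      have := congrArg SimpleGraph.Walk.length (p.take_spec hx)
      rw [SimpleGraph.Walk.length_append] at this
      simp only [r, SimpleGraph.Walk.length_append, SimpleGraph.Walk.length_cons]
      omega
    have hsup : ∀ z, z ∈ r.support ↔ z = d.snd ∨ z ∈ p.support := by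
      intro z
      have := (p.takeUntil _ hx).mem_support_append_iff (p.dropUntil _ hx) (t := z)
      rw [p.take_spec hx] at this
      rw [this]
      simp only [r, SimpleGraph.Walk.mem_support_append_iff, SimpleGraph.Walk.support_cons,
        List.mem_cons]
      have h0 : z = d.fst → z ∈ (p.takeUntil _ hx).support := by
        rintro rfl; simp
      tauto
    have hcard : r.support.toFinset.card = p.support.toFinset.card + 1 := by
      have : r.support.toFinset = insert d.snd p.support.toFinset := by
        ext z; simp [hsup]
      rw [this, Finset.card_insert_of_notMem (by simpa using hy)]
    refine ⟨r, ?_, by omega, Or.inr (by omega)⟩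
    intro u hu
    rcases (hsup u).1 hu with rfl | hu
    · exact hdy
    · exact h1 u hu

/-- A tree with `n ≥ 3` vertices and exactly `L` leaves has a closed 1-covering walk
whose support consists of internal vertices (degree at least 2) only, and whose length
is at most `2 * (n - L - 1)`. -/
theorem tree_closed_one_covering_walk {V : Type*} [Fintype V] [DecidableEq V]
    (G : SimpleGraph V) [DecidableRel G.Adj] (hT : G.IsTree) (h3 : 3 ≤ Fintype.card V)
    (L : ℕ) (hL : L = (Finset.univ.filter fun v : V => G.degree v = 1).card) :
    ∃ (v : V) (p : G.Walk v v),
      (∀ u ∈ p.support, 2 ≤ G.degree u) ∧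
      p.IsOneCovering G ∧
      p.length ≤ 2 * (Fintype.card V - L - 1) := by
  have hc := hT.connected
  obtain ⟨v, hv⟩ : ∃ v, 2 ≤ G.degree v := by
    by_contra! hcon
    have e1 := hT.card_edgeFinset
    have e2 := G.sum_degrees_eq_twice_card_edges
    have e3 : ∑ v, G.degree v ≤ ∑ _v : V, 1 :=
      Finset.sum_le_sum fun i _ => by have := hcon i; omega
    simp at e3
    omega
  obtain ⟨p, h1, h2, h4⟩ := aux_grow G hc v hv (Fintype.card V)
  have hall : ∀ w, 2 ≤ G.degree w → w ∈ p.support := by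
    rcases h4 with h4 | h4
    · exact h4
    · intro w _
      have : p.support.toFinset = Finset.univ :=
        (Finset.card_eq_iff_eq_univ _).1 (le_antisymm (Finset.card_le_univ _) h4)
      have hw := Finset.mem_univ w
      rw [← this] at hw
      simpa using hw
  refine ⟨v, p, h1, ?_, ?_⟩
  · intro w
    by_cases hw : 2 ≤ G.degree w
    · exact Or.inl (hall w hw)
    right
    obtain ⟨q, hq⟩ := hc.exists_isPath v w
    have hne : v ≠ w := by rintro rfl; exact hw hv
    have hadj := q.adj_penultimate (SimpleGraph.Walk.not_nil_of_ne hne)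
    exact ⟨q.penultimate, hall _ (aux_path_degree G q hq hv _
      (q.getVert_mem_support _) hadj.ne), hadj.symm⟩
  · have hd : Disjoint p.support.toFinset (Finset.univ.filter fun v : V => G.degree v = 1) := by
      rw [Finset.disjoint_left]
      intro a ha hb
      have := h1 a (by simpa using ha)
      simp at hb
      omega
    have := Finset.card_le_univ
      (p.support.toFinset ∪ (Finset.univ.filter fun v : V => G.degree v = 1))
    rw [Finset.card_union_of_disjoint hd] at this
    omega
end

section
/- Let G be a finite connected simple graph on n vertices with n ≥ 3. Then G has a 1-covering walk of length at most 2n − 3 whose support contains at most n − 2 distinct vertices. -/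
theorem ocw_aux (n : ℕ) : ∀ {V : Type*} [Fintype V] [DecidableEq V]
    (G : SimpleGraph V) (_ : G.Connected) (_ : Fintype.card V = n + 3),
    ∃ (u v : V) (p : G.Walk u v),
      p.IsOneCovering G ∧
      p.length ≤ 2 * n + 3 ∧
      p.support.toFinset.card ≤ n + 1 := by
  induction n with
  | zero =>
    intro V _ _ G hG hn
    have : Nontrivial V := Fintype.one_lt_card_iff_nontrivial.mp (by omega)
    obtain ⟨v, hv⟩ := hG.exists_connected_induce_compl_singleton_of_finite_nontrivial
    have hv2 : ∃ s, G.Adj v s := hG.preconnected.exists_adj_of_nontrivial v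
    obtain ⟨s, hs⟩ := hv2
    have hc : Fintype.card ({v}ᶜ : Set V) = 2 := by
      rw [Fintype.card_compl_set]; simp [hn]
    have : Nontrivial ({v}ᶜ : Set V) := Fintype.one_lt_card_iff_nontrivial.mp (by omega)
    obtain ⟨⟨t, ht⟩, hst⟩ := hv.preconnected.exists_adj_of_nontrivial ⟨s, hs.ne'⟩
    have hst' : G.Adj s t := hst
    refine ⟨s, s, .nil, ?_, by simp, by simp⟩
    intro w
    have h3 : ({v, s, t} : Finset V) = Finset.univ := by
      apply Finset.eq_univ_of_card
      rw [Finset.card_eq_three.mpr ⟨v, s, t, hs.ne, fun h => ht h.symm, hst'.ne, rfl⟩, hn]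
    have hw : w ∈ ({v, s, t} : Finset V) := by rw [h3]; simp
    simp only [Finset.mem_insert, Finset.mem_singleton] at hw
    rcases hw with rfl | rfl | rfl
    · right; exact ⟨s, by simp, hs⟩
    · left; simp
    · right; exact ⟨s, by simp, hst'.symm⟩
  | succ n ih =>
    intro V _ _ G hG hn
    have : Nontrivial V := Fintype.one_lt_card_iff_nontrivial.mp (by omega)
    obtain ⟨v, hv⟩ := hG.exists_connected_induce_compl_singleton_of_finite_nontrivial
    obtain ⟨x, hx⟩ := hG.preconnected.exists_adj_of_nontrivial v
    have hc : Fintype.card ({v}ᶜ : Set V) = n + 3 := by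
      rw [Fintype.card_compl_set]; simp [hn]
    obtain ⟨a, b, p, hp, hl, hs⟩ := ih _ hv hc
    obtain ⟨q, hq1, hq2⟩ : ∃ q : G.Walk a.1 b.1, q.length = p.length ∧
        q.support = p.support.map Subtype.val :=
      ⟨p.map (SimpleGraph.Embedding.induce _).toHom, SimpleGraph.Walk.length_map _ _,
        SimpleGraph.Walk.support_map _ _⟩
    have hqs : q.support.toFinset.card ≤ n + 1 := by
      refine le_trans ?_ hs
      have : q.support.toFinset = p.support.toFinset.image Subtype.val := by
        ext w; rw [hq2]; simp
      rw [this]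
      exact Finset.card_image_le
    have hcov : ∀ w, w ≠ v → w ∈ q.support ∨ ∃ y ∈ q.support, G.Adj w y := by
      intro w hw
      rcases hp ⟨w, hw⟩ with h | ⟨y, hy, h⟩
      · left; rw [hq2]; exact List.mem_map.mpr ⟨_, h, rfl⟩
      · right; exact ⟨y.1, by rw [hq2]; exact List.mem_map.mpr ⟨_, hy, rfl⟩, h⟩
    rcases hcov x hx.ne' with h | ⟨y, hy, hxy⟩
    · refine ⟨_, _, q, ?_, by omega, by omega⟩
      intro w
      by_cases hw : w = v
      · subst hw; exact Or.inr ⟨x, h, hx⟩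
      · exact hcov w hw
    · have hr : ∃ r : G.Walk a.1 b.1, r.length = q.length + 2 ∧
          ∀ w, w ∈ r.support ↔ w = x ∨ w ∈ q.support := by
        obtain ⟨q1, q2, rfl⟩ := SimpleGraph.Walk.mem_support_iff_exists_append.mp hy
        refine ⟨q1.append (.cons hxy.symm (.cons hxy q2)), by simp; omega, ?_⟩
        intro w
        have := q1.end_mem_support
        simp only [SimpleGraph.Walk.mem_support_append_iff, SimpleGraph.Walk.support_cons,
          List.mem_cons]
        grind
      obtain ⟨r, hr1, hr2⟩ := hr
      refine ⟨_, _, r, ?_, by omega, ?_⟩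
      · intro w
        by_cases hw : w = v
        · subst hw; exact Or.inr ⟨x, by simp [hr2], hx⟩
        · rcases hcov w hw with h | ⟨z, hz, h⟩
          · exact Or.inl ((hr2 w).2 (Or.inr h))
          · exact Or.inr ⟨z, (hr2 z).2 (Or.inr hz), h⟩
      · have : r.support.toFinset = insert x q.support.toFinset := by
          ext w; simp [hr2]
        rw [this]
        exact (Finset.card_insert_le _ _).trans (by omega)

/-- A finite connected simple graph on `n ≥ 3` vertices has a 1-covering walk of length
at most `2n - 3` whose support contains at most `n - 2` distinct vertices. -/
theorem one_covering_walk_length_and_support {V : Type*} [Fintype V] [DecidableEq V]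
    (G : SimpleGraph V) (hG : G.Connected) (hn : 3 ≤ Fintype.card V) :
    ∃ (u v : V) (p : G.Walk u v),
      p.IsOneCovering G ∧
      p.length ≤ 2 * Fintype.card V - 3 ∧
      p.support.toFinset.card ≤ Fintype.card V - 2 := by
  obtain ⟨n, hn'⟩ := Nat.exists_eq_add_of_le' hn
  obtain ⟨u, v, p, h1, h2, h3⟩ := ocw_aux n G hG hn'
  exact ⟨u, v, p, h1, by omega, by omega⟩
end

section
/- Let m ≥ 2 be an integer, let ε be a real number with 0 < ε < 1, and set t = ⌈(2/ε)·ln(2m)⌉. Then there exist integers k₁, …, k_t ∈ {0, 1, …, m − 1} (not necessarily distinct) such that for every integer g not divisible by m, ((1/t)·∑_{i=1}^{t} cos(2π·k_i·g/m))² < ε. -/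
open Real

lemma aux_exp (l x : ℝ) (h1 : -1 ≤ x) (h2 : x ≤ 1) :
    Real.exp (l * x) ≤ Real.cosh l + x * Real.sinh l := by
  have h := convexOn_exp.2 (Set.mem_univ l) (Set.mem_univ (-l))
    (show (0:ℝ) ≤ (1 + x) / 2 by linarith) (show (0:ℝ) ≤ (1 - x) / 2 by linarith) (by ring)
  simp only [smul_eq_mul] at h
  rw [Real.cosh_eq, Real.sinh_eq]
  have e : (1 + x) / 2 * l + (1 - x) / 2 * -l = l * x := by ring
  rw [e] at h
  linarith

lemma aux_cos (m : ℕ) (hm : 2 ≤ m) (g : ℤ) (hg : ¬ (m : ℤ) ∣ g) :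
    ∑ j : Fin m, Real.cos (2 * Real.pi * ((j : ℕ) : ℝ) * g / m) = 0 := by
  have hm0 : (m : ℂ) ≠ 0 := by norm_cast; omega
  set z : ℂ := Complex.exp (2 * Real.pi * Complex.I * g / m) with hz
  have hz1 : z ≠ 1 := by
    intro h
    rw [hz, Complex.exp_eq_one_iff] at h
    obtain ⟨n, hn⟩ := h
    have h2 := Complex.two_pi_I_ne_zero
    rw [div_eq_iff hm0] at hn
    have h3 : (2 * Real.pi * Complex.I) * (g : ℂ) = (2 * Real.pi * Complex.I) * (m * n) := by
      rw [hn]; ring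
    have h4 := mul_left_cancel₀ h2 h3
    exact hg ⟨n, by exact_mod_cast h4⟩
  have hzm : z ^ m = 1 := by
    rw [hz, ← Complex.exp_nat_mul, Complex.exp_eq_one_iff]
    exact ⟨g, by field_simp⟩
  have hs : ∑ j ∈ Finset.range m, z ^ j = 0 := by
    have := geom_sum_mul z m
    rw [hzm, sub_self] at this
    exact (mul_eq_zero.mp this).resolve_right (sub_ne_zero.mpr hz1)
  rw [Fin.sum_univ_eq_sum_range (fun j : ℕ => Real.cos (2 * Real.pi * (j : ℝ) * g / m))]
  have := congrArg Complex.re hs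
  rw [Complex.re_sum, Complex.zero_re] at this
  rw [← this]
  refine Finset.sum_congr rfl fun j _ => ?_
  rw [hz, ← Complex.exp_nat_mul, ← Complex.exp_ofReal_mul_I_re]
  congr 2
  push_cast
  ring

lemma aux_mgf (m : ℕ) (hm : 2 ≤ m) (g : ℤ) (hg : ¬ (m : ℤ) ∣ g) (l : ℝ) (t : ℕ) :
    ∑ k : Fin t → Fin m, Real.exp (l * ∑ i, Real.cos (2 * Real.pi * ((k i : ℕ) : ℝ) * g / m))
      ≤ (m : ℝ) ^ t * Real.exp (t * (l ^ 2 / 2)) := by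
  have h : ∑ j : Fin m, Real.exp (l * Real.cos (2 * Real.pi * ((j : ℕ) : ℝ) * g / m))
      ≤ m * Real.exp (l ^ 2 / 2) := by
    calc _ ≤ ∑ j : Fin m, (Real.cosh l
            + Real.cos (2 * Real.pi * ((j : ℕ) : ℝ) * g / m) * Real.sinh l) :=
          Finset.sum_le_sum fun j _ => aux_exp _ _ (Real.neg_one_le_cos _) (Real.cos_le_one _)
      _ = m * Real.cosh l := by
          rw [Finset.sum_add_distrib, ← Finset.sum_mul, aux_cos m hm g hg]; simp
      _ ≤ _ := by gcongr; exact Real.cosh_le_exp_half_sq l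
  calc _ = (∑ j : Fin m, Real.exp (l * Real.cos (2 * Real.pi * ((j : ℕ) : ℝ) * g / m))) ^ t := by
        rw [Fintype.sum_pow]
        refine Finset.sum_congr rfl fun k _ => ?_
        rw [Finset.mul_sum, Real.exp_sum]
    _ ≤ (m * Real.exp (l ^ 2 / 2)) ^ t := by
        gcongr
    _ = _ := by rw [mul_pow, Real.exp_nat_mul]

/-- For every integer `m ≥ 2` and `0 < ε < 1`, with `t = ⌈(2/ε) ln (2m)⌉`, there exists a
"good" set of parameters `k₁, …, k_t ∈ {0, …, m-1}` such that for every integer `g` not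
divisible by `m`, `((1/t) ∑ᵢ cos(2π kᵢ g / m))² < ε`. -/
theorem exists_good_set (m : ℕ) (hm : 2 ≤ m) (ε : ℝ) (hε : 0 < ε) (hε1 : ε < 1)
    (t : ℕ) (ht : t = ⌈(2 / ε) * Real.log (2 * m)⌉₊) :
    ∃ k : Fin t → ℕ, (∀ i, k i < m) ∧
      ∀ g : ℤ, ¬ ((m : ℤ) ∣ g) →
        ((1 / (t : ℝ)) * ∑ i, Real.cos (2 * Real.pi * (k i) * g / m)) ^ 2 < ε := by
  have hmR : (2 : ℝ) ≤ m := by exact_mod_cast hm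
  have hlog : 0 < Real.log (2 * m) := Real.log_pos (by linarith)
  have htle : (2 / ε) * Real.log (2 * m) ≤ t := by rw [ht]; exact Nat.le_ceil _
  have htpos : (0 : ℝ) < t := lt_of_lt_of_le (by positivity) htle
  have hexp : 2 * (m : ℝ) ≤ Real.exp (t * (ε / 2)) := by
    rw [← Real.log_le_iff_le_exp (by positivity)]
    have : Real.log (2 * m) = (2 / ε) * Real.log (2 * m) * (ε / 2) := by field_simp
    rw [this]; gcongr
  set l := Real.sqrt ε with hl
  have hl2 : l ^ 2 = ε := Real.sq_sqrt hε.le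
  have hlpos : 0 < l := Real.sqrt_pos.mpr hε
  let S : (Fin t → Fin m) → ℤ → ℝ := fun k g =>
    ∑ i, Real.cos (2 * Real.pi * ((k i : ℕ) : ℝ) * g / m)
  let E := Real.exp (t * (ε / 2))
  have hE : 0 < E := Real.exp_pos _
  let W : (Fin t → Fin m) → ℝ := fun k =>
    ∑ g ∈ Finset.Ioo (0 : ℤ) m, (Real.exp (l * S k g) + Real.exp (-l * S k g))
  have hndvd : ∀ g ∈ Finset.Ioo (0 : ℤ) m, ¬ (m : ℤ) ∣ g := by
    intro g hg h
    rw [Finset.mem_Ioo] at hg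
    exact absurd (Int.le_of_dvd hg.1 h) (by omega)
  have hW : ∑ k, W k < ∑ k : Fin t → Fin m, 2 * m * E := by
    have hc : ((Finset.Ioo (0 : ℤ) m).card : ℝ) = m - 1 := by
      rw [Int.card_Ioo]
      have : ((m : ℤ) - 0 - 1).toNat = m - 1 := by omega
      rw [this, Nat.cast_sub (by omega)]; simp
    calc ∑ k, W k = ∑ g ∈ Finset.Ioo (0 : ℤ) m,
          (∑ k, Real.exp (l * S k g) + ∑ k, Real.exp (-l * S k g)) := by
          rw [Finset.sum_comm]; simp only [Finset.sum_add_distrib]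
      _ ≤ ∑ g ∈ Finset.Ioo (0 : ℤ) m, ((m : ℝ) ^ t * E + (m : ℝ) ^ t * E) := by
          refine Finset.sum_le_sum fun g hg => add_le_add ?_ ?_
          · have := aux_mgf m hm g (hndvd g hg) l t
            rwa [hl2] at this
          · have := aux_mgf m hm g (hndvd g hg) (-l) t
            rwa [neg_sq, hl2] at this
      _ = (m - 1) * (2 * (m : ℝ) ^ t * E) := by
          rw [Finset.sum_const, nsmul_eq_mul, hc]; ring
      _ < m * (2 * (m : ℝ) ^ t * E) := by
          gcongr; linarith
      _ = _ := by simp; ring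
  obtain ⟨k, -, hk⟩ := Finset.exists_lt_of_sum_lt hW
  refine ⟨fun i => k i, fun i => (k i).2, fun g hg => ?_⟩
  have hm0 : (m : ℤ) ≠ 0 := by omega
  set r := g % m with hr
  have hrmem : r ∈ Finset.Ioo (0 : ℤ) m := by
    rw [Finset.mem_Ioo]
    have h1 := Int.emod_nonneg g hm0
    have h2 := Int.emod_lt_of_pos g (show (0 : ℤ) < m by omega)
    have h3 : r ≠ 0 := fun h => hg (Int.dvd_of_emod_eq_zero h)
    omega
  have hS : ∑ i, Real.cos (2 * Real.pi * ((k i : ℕ) : ℝ) * g / m) = S k r := by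
    refine Finset.sum_congr rfl fun i _ => ?_
    have hg' : (g : ℝ) = r + m * (g / m : ℤ) := by
      exact_mod_cast (Int.emod_add_mul_ediv g m).symm
    rw [← Real.cos_add_int_mul_two_pi (2 * Real.pi * ((k i : ℕ) : ℝ) * r / m) (((k i : ℕ) : ℤ) * (g / m : ℤ)), hg']
    congr 1
    have : (m : ℝ) ≠ 0 := by positivity
    push_cast
    field_simp
  have hWr : Real.exp (l * S k r) + Real.exp (-l * S k r) < E * E := by
    calc _ ≤ W k := Finset.single_le_sum
            (f := fun g => Real.exp (l * S k g) + Real.exp (-l * S k g))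
            (fun _ _ => by positivity) hrmem
      _ < 2 * m * E := hk
      _ ≤ E * E := by gcongr
  have hEE : E * E = Real.exp (l * (t * l)) := by
    rw [← Real.exp_add]; congr 1; rw [← hl2]; ring
  rw [hEE] at hWr
  have p1 := Real.exp_pos (l * S k r)
  have p2 := Real.exp_pos (-l * S k r)
  have q1 : S k r < t * l :=
    lt_of_mul_lt_mul_left (Real.exp_lt_exp.mp (by linarith : Real.exp (l * S k r) < _)) hlpos.le
  have q2 : -S k r < t * l := by
    have := Real.exp_lt_exp.mp (by linarith : Real.exp (-l * S k r) < _)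
    exact lt_of_mul_lt_mul_left (by linarith) hlpos.le
  rw [hS, ← hl2]
  refine sq_lt_sq' ?_ ?_
  · rw [one_div, inv_mul_eq_div, lt_div_iff₀ htpos]; linarith
  · rw [one_div, inv_mul_eq_div, div_lt_iff₀ htpos]; linarith
end

section
/- For every real number ξ, the 4×4 complex matrix identity SWAP · CR_y(ξ) = CNOT₁₂ · CNOT₂₁ · (I₂ ⊗ R_y(−ξ/2)) · CNOT₁₂ · (I₂ ⊗ R_y(ξ/2)) holds; in particular, a controlled-R_y gate followed by a SWAP gate on the same pair of qubits can be implemented by a circuit containing exactly three CNOT gates and two single-qubit R_y gates. -/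
open Matrix Kronecker

/-- The single-qubit rotation `R_y(ξ)`. -/
noncomputable def Ry (ξ : ℝ) : Matrix (Fin 2) (Fin 2) ℂ :=
  !![Real.cos (ξ / 2), -Real.sin (ξ / 2); Real.sin (ξ / 2), Real.cos (ξ / 2)]

/-- The controlled rotation `CR_y(ξ) = diag(I₂, R_y(ξ))`, control on the first
(more significant) qubit. -/
noncomputable def CRy (ξ : ℝ) : Matrix (Fin 4) (Fin 4) ℂ :=
  !![1, 0, 0, 0;
     0, 1, 0, 0;
     0, 0, Real.cos (ξ / 2), -Real.sin (ξ / 2);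
     0, 0, Real.sin (ξ / 2), Real.cos (ξ / 2)]

/-- The CNOT gate with control on the first (more significant) qubit. -/
def CNOT12 : Matrix (Fin 4) (Fin 4) ℂ :=
  !![1, 0, 0, 0; 0, 1, 0, 0; 0, 0, 0, 1; 0, 0, 1, 0]

/-- The CNOT gate with control on the second (less significant) qubit. -/
def CNOT21 : Matrix (Fin 4) (Fin 4) ℂ :=
  !![1, 0, 0, 0; 0, 0, 0, 1; 0, 0, 1, 0; 0, 1, 0, 0]

/-- The SWAP gate on two qubits. -/
def SWAPgate : Matrix (Fin 4) (Fin 4) ℂ :=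
  !![1, 0, 0, 0; 0, 0, 1, 0; 0, 1, 0, 0; 0, 0, 0, 1]

theorem reindex_one_kron (A : Matrix (Fin 2) (Fin 2) ℂ) :
    (Matrix.reindex finProdFinEquiv finProdFinEquiv
        ((1 : Matrix (Fin 2) (Fin 2) ℂ) ⊗ₖ A) : Matrix (Fin 4) (Fin 4) ℂ) =
      !![A 0 0, A 0 1, 0, 0; A 1 0, A 1 1, 0, 0; 0, 0, A 0 0, A 0 1; 0, 0, A 1 0, A 1 1] := by
  have h0 : finProdFinEquiv.symm (0 : Fin (2 * 2)) = ((0 : Fin 2), (0 : Fin 2)) := by decide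
  have h1 : finProdFinEquiv.symm (1 : Fin (2 * 2)) = ((0 : Fin 2), (1 : Fin 2)) := by decide
  have h2 : finProdFinEquiv.symm (2 : Fin (2 * 2)) = ((1 : Fin 2), (0 : Fin 2)) := by decide
  have h3 : finProdFinEquiv.symm (3 : Fin (2 * 2)) = ((1 : Fin 2), (1 : Fin 2)) := by decide
  ext i j
  rw [Matrix.reindex_apply, Matrix.submatrix_apply, Matrix.kroneckerMap_apply]
  fin_cases i <;> fin_cases j <;>
    first
    | (erw [h0]; simp; done)
    | (erw [h0, h1]; simp)
    | (erw [h0, h2]; simp)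
    | (erw [h0, h3]; simp)
    | (erw [h1, h0]; simp)
    | (erw [h1]; simp; done)
    | (erw [h1, h2]; simp)
    | (erw [h1, h3]; simp)
    | (erw [h2, h0]; simp)
    | (erw [h2, h1]; simp)
    | (erw [h2]; simp; done)
    | (erw [h2, h3]; simp)
    | (erw [h3, h0]; simp)
    | (erw [h3, h1]; simp)
    | (erw [h3, h2]; simp)
    | (erw [h3]; simp; done)

/-- A controlled-`R_y` gate followed by a SWAP gate on the same pair of qubits is
implemented by a circuit with exactly three CNOT gates and two single-qubit rotations:
`SWAP ⬝ CR_y(ξ) = CNOT₁₂ ⬝ CNOT₂₁ ⬝ (I₂ ⊗ R_y(-ξ/2)) ⬝ CNOT₁₂ ⬝ (I₂ ⊗ R_y(ξ/2))`. -/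
theorem SWAP_CRy_decomposition (ξ : ℝ) :
    SWAPgate * CRy ξ =
      CNOT12 * CNOT21 *
      (Matrix.reindex finProdFinEquiv finProdFinEquiv
        ((1 : Matrix (Fin 2) (Fin 2) ℂ) ⊗ₖ Ry (-ξ / 2)) : Matrix (Fin 4) (Fin 4) ℂ) *
      CNOT12 *
      (Matrix.reindex finProdFinEquiv finProdFinEquiv
        ((1 : Matrix (Fin 2) (Fin 2) ℂ) ⊗ₖ Ry (ξ / 2)) : Matrix (Fin 4) (Fin 4) ℂ) := by
  rw [reindex_one_kron, reindex_one_kron]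
  have e : -ξ / 2 / 2 = -(ξ / 2 / 2) := by ring
  have e2 : ξ / 2 = 2 * (ξ / 2 / 2) := by ring
  have hc : Real.cos (ξ / 2) = 2 * Real.cos (ξ / 2 / 2) ^ 2 - 1 := by
    conv_lhs => rw [e2, Real.cos_two_mul]
  have hs : Real.sin (ξ / 2) = 2 * Real.sin (ξ / 2 / 2) * Real.cos (ξ / 2 / 2) := by
    conv_lhs => rw [e2, Real.sin_two_mul]
  have h1 : ((Real.sin (ξ / 2 / 2) : ℝ) : ℂ) ^ 2 + ((Real.cos (ξ / 2 / 2) : ℝ) : ℂ) ^ 2 = 1 := by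
    exact_mod_cast Real.sin_sq_add_cos_sq (ξ / 2 / 2)
  simp only [SWAPgate, CRy, CNOT12, CNOT21, Ry, e, Real.cos_neg, Real.sin_neg, hc, hs]
  push_cast [-Complex.ofReal_sin, -Complex.ofReal_cos]
  generalize ((Real.sin (ξ / 2 / 2) : ℝ) : ℂ) = s at *
  generalize ((Real.cos (ξ / 2 / 2) : ℝ) : ℂ) = c at *
  ext i j
  fin_cases i <;> fin_cases j <;>
    simp [Matrix.mul_apply, Fin.sum_univ_four] <;> first | done | ring1 | linear_combination h1 | linear_combination -h1
end

section
/- Let t ≥ 3 and let C_t be the cycle graph on vertex set ℤ/tℤ, in which i is adjacent to i + 1 for every i. Let w assign a nonnegative real weight to each edge of C_t, let W be the sum of the weights of all t edges, and let M be the maximum edge weight. Define the weight of a walk as the sum of w over the edges in its edge list, counted with multiplicity. Then for every vertex v of C_t, the minimum weight over all closed walks starting and ending at v whose support is all of ℤ/tℤ equals min(W, 2(W − M)), and this minimum is attained by some such walk. -/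
/-- The cycle graph on `ℤ/tℤ`, in which `i` is adjacent to `i + 1` for every `i`. -/
def cycleZMod (t : ℕ) : SimpleGraph (ZMod t) :=
  SimpleGraph.fromRel (fun i j => j = i + 1)

theorem cyc_two_ne {t : ℕ} (ht : 3 ≤ t) : (2 : ZMod t) ≠ 0 := by
  intro h
  have h2 : ((2 : ℕ) : ZMod t) = 0 := by exact_mod_cast h
  rw [ZMod.natCast_eq_zero_iff] at h2
  have := Nat.le_of_dvd (by norm_num) h2
  omega

theorem cyc_one_ne {t : ℕ} (ht : 3 ≤ t) : (1 : ZMod t) ≠ 0 := by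
  intro h
  apply cyc_two_ne ht
  linear_combination 2 * h

theorem cyc_adj {t : ℕ} (ht : 3 ≤ t) (i : ZMod t) : (cycleZMod t).Adj i (i + 1) := by
  rw [cycleZMod, SimpleGraph.fromRel_adj]
  refine ⟨fun h => cyc_one_ne ht ?_, Or.inl rfl⟩
  linear_combination -h

theorem cyc_inj {t : ℕ} (ht : 3 ≤ t) {i k : ZMod t} :
    s(k, k + 1) = s(i, i + 1) ↔ k = i := by
  constructor
  · intro h
    rw [Sym2.eq_iff] at h
    rcases h with h | ⟨h1, h2⟩
    · exact h.1
    · exact absurd (by linear_combination h2 - h1) (cyc_two_ne ht)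
  · rintro rfl; rfl

theorem cyc_adj_cases {t : ℕ} {a b : ZMod t} (h : (cycleZMod t).Adj a b) :
    ∃ k : ZMod t, s(a, b) = s(k, k + 1) ∧ ((a = k ∧ b = k + 1) ∨ (a = k + 1 ∧ b = k)) := by
  rw [cycleZMod, SimpleGraph.fromRel_adj] at h
  rcases h.2 with h | h
  · exact ⟨a, by rw [h], Or.inl ⟨rfl, h⟩⟩
  · exact ⟨b, by rw [h, Sym2.eq_swap], Or.inr ⟨h, rfl⟩⟩

theorem cyc_weight {t : ℕ} [NeZero t] (ht : 3 ≤ t) (w : Sym2 (ZMod t) → ℝ) {u v : ZMod t}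
    (p : (cycleZMod t).Walk u v) :
    (p.edges.map w).sum = ∑ i : ZMod t, (p.edges.count s(i, i + 1) : ℝ) * w s(i, i + 1) := by
  induction p with
  | nil => simp
  | cons h q ih =>
    obtain ⟨k, hk, -⟩ := cyc_adj_cases h
    simp only [SimpleGraph.Walk.edges_cons, hk, List.map_cons, List.sum_cons, ih,
      List.count_cons, beq_iff_eq, cyc_inj ht, Nat.cast_add, add_mul, Finset.sum_add_distrib]
    simp [add_comm]

theorem cyc_parity {t : ℕ} [NeZero t] (ht : 3 ≤ t) {u v : ZMod t}
    (p : (cycleZMod t).Walk u v) (i : ZMod t) :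
    (p.edges.count s(i, i + 1) : ZMod 2) + (p.edges.count s(i + 1, i + 1 + 1) : ZMod 2)
      = (if u = i + 1 then 1 else 0) + (if v = i + 1 then 1 else 0) := by
  have two : (2 : ZMod 2) = 0 := rfl
  induction p with
  | nil => simp; split_ifs <;> rfl
  | @cons a b c h q ih =>
    obtain ⟨k, hk, hab⟩ := cyc_adj_cases h
    simp only [SimpleGraph.Walk.edges_cons, hk, 
      List.count_cons, beq_iff_eq, cyc_inj ht, Nat.cast_add, Nat.cast_ite, Nat.cast_one,
      Nat.cast_zero]
    rcases hab with ⟨rfl, rfl⟩ | ⟨rfl, rfl⟩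
    · simp only [add_left_inj] at ih ⊢
      linear_combination ih + (if a = i then 1 else 0) * two
    · simp only [add_left_inj] at ih ⊢
      linear_combination ih + (if b = i + 1 then 1 else 0) * two

theorem cyc_parity_const {t : ℕ} [NeZero t] (ht : 3 ≤ t) {v : ZMod t}
    (p : (cycleZMod t).Walk v v) (i : ZMod t) :
    (p.edges.count s(i, i + 1) : ZMod 2) = (p.edges.count s(0, 0 + 1) : ZMod 2) := by
  have two : (2 : ZMod 2) = 0 := rfl
  have key : ∀ n : ℕ, (p.edges.count s((n : ZMod t), (n : ZMod t) + 1) : ZMod 2)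
      = (p.edges.count s(0, 0 + 1) : ZMod 2) := by
    intro n
    induction n with
    | zero => simp
    | succ n ih =>
      have := cyc_parity ht p (n : ZMod t)
      push_cast
      rw [← ih]
      linear_combination this + ((if v = (n : ZMod t) + 1 then 1 else 0) 
        - (p.edges.count s((n : ZMod t), (n : ZMod t) + 1) : ZMod 2)) * two
  have := key i.val
  rwa [ZMod.natCast_zmod_val] at this

theorem cyc_invariant {t : ℕ} (S : ZMod t → Prop) {u v : ZMod t}
    (p : (cycleZMod t).Walk u v)
    (hS : ∀ k, s(k, k + 1) ∈ p.edges → (S k ↔ S (k + 1))) :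
    ∀ x ∈ p.support, (S u ↔ S x) := by
  induction p with
  | nil => simp
  | @cons a b c h q ih =>
    obtain ⟨k, hk, hab⟩ := cyc_adj_cases h
    have h1 : S a ↔ S b := by
      have := hS k (by simp [hk])
      rcases hab with ⟨rfl, rfl⟩ | ⟨rfl, rfl⟩
      · exact this
      · exact this.symm
    intro x hx
    rw [SimpleGraph.Walk.support_cons, List.mem_cons] at hx
    rcases hx with rfl | hx
    · rfl
    · exact h1.trans (ih (fun k hk => hS k (by simp [hk])) x hx)

theorem cyc_missing {t : ℕ} [NeZero t] (ht : 3 ≤ t) {v : ZMod t}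
    (p : (cycleZMod t).Walk v v) (hp : ∀ u, u ∈ p.support) (i j : ZMod t)
    (hi : s(i, i + 1) ∉ p.edges) (hj : s(j, j + 1) ∉ p.edges) : i = j := by
  by_contra hij
  obtain ⟨n, rfl⟩ : ∃ n, t = n + 1 := ⟨t - 1, by omega⟩
  have inv := cyc_invariant (fun x => (x - (i + 1)).val ≤ (j - (i + 1)).val) p (by
    intro k hk
    have hki : k ≠ i := by rintro rfl; exact hi hk
    have hkj : k ≠ j := by rintro rfl; exact hj hk
    have e : k + 1 - (i + 1) = (k - (i + 1)) + 1 := by ring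
    have hne : (k - (i + 1)).val ≠ (j - (i + 1)).val := by
      intro h
      have := ZMod.val_injective _ h
      exact hkj (by linear_combination this)
    have hv : (k + 1 - (i + 1)).val = (k - (i + 1)).val + 1 := by
      have hlt := ZMod.val_lt (k - (i + 1))
      have : (k - (i + 1)).val ≠ n := by
        intro h
        have h2 : (k - (i + 1)).val = (-1 : ZMod (n + 1)).val := by rw [h, ZMod.val_neg_one]
        have := ZMod.val_injective _ h2
        exact hki (by linear_combination this)
      have : Fact (1 < n + 1) := ⟨by omega⟩
      rw [e, ZMod.val_add_of_lt, ZMod.val_one]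
      rw [ZMod.val_one]; omega
    simp only [hv]
    omega)
  have h1 := inv i (hp i)
  have h2 := inv j (hp j)
  have h3 := h1.symm.trans h2
  simp only [le_refl, iff_true] at h3
  have e : i - (i + 1) = -1 := by ring
  rw [e, ZMod.val_neg_one] at h3
  have hlt := ZMod.val_lt (j - (i + 1))
  have h4 : (j - (i + 1)).val = (-1 : ZMod (n + 1)).val := by rw [ZMod.val_neg_one]; omega
  have := ZMod.val_injective _ h4
  exact hij (by linear_combination -this)

theorem cyc_fwd {t : ℕ} (ht : 3 ≤ t) (w : Sym2 (ZMod t) → ℝ) (a : ZMod t) (n : ℕ) :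
    ∃ p : (cycleZMod t).Walk a (a + n), (∀ k ≤ n, a + (k : ZMod t) ∈ p.support) ∧
      (p.edges.map w).sum = ∑ k ∈ Finset.range n, w s(a + k, a + k + 1) := by
  induction n with
  | zero =>
    refine ⟨SimpleGraph.Walk.nil.copy rfl (by simp), ?_, by simp⟩
    intro k hk
    obtain rfl : k = 0 := by omega
    simp
  | succ n ih =>
    obtain ⟨p, hp, hs⟩ := ih
    refine ⟨(p.concat (cyc_adj ht _)).copy rfl (by push_cast; ring), ?_, ?_⟩
    · intro k hk
      rcases Nat.lt_or_ge n k with h | h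
      · obtain rfl : k = n + 1 := by omega
        exact SimpleGraph.Walk.end_mem_support _
      · simp [SimpleGraph.Walk.support_concat, hp k h]
    · simp [SimpleGraph.Walk.edges_concat, hs, Finset.sum_range_succ]

theorem cyc_sum {t : ℕ} [NeZero t] (f : ZMod t → ℝ) (a : ZMod t) :
    ∑ k ∈ Finset.range t, f (a + k) = ∑ i, f i := by
  refine Finset.sum_nbij' (fun k => a + (k : ZMod t)) (fun x => (x - a).val) ?_ ?_ ?_ ?_ ?_
  · simp
  · intro x _; simpa using ZMod.val_lt _
  · intro k hk
    simp only [add_sub_cancel_left]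
    exact ZMod.val_cast_of_lt (by simpa using hk)
  · intro x _; simp
  · simp

/-- Let `t ≥ 3`, let `w` assign a nonnegative weight to each edge of the cycle graph
`C_t` on `ℤ/tℤ`, let `W` be the total weight of all `t` edges and `M` the maximum edge
weight.  Then for every vertex `v`, the minimum weight of a closed walk at `v` whose
support is all of `ℤ/tℤ` equals `min W (2 (W - M))`, and it is attained. -/
theorem cycle_min_weight_closed_spanning_walk (t : ℕ) [NeZero t] (ht : 3 ≤ t)
    (w : Sym2 (ZMod t) → ℝ) (hw : ∀ e ∈ (cycleZMod t).edgeSet, 0 ≤ w e)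
    (W M : ℝ)
    (hW : W = ∑ i : ZMod t, w s(i, i + 1))
    (hM : M = Finset.univ.sup' Finset.univ_nonempty (fun i : ZMod t => w s(i, i + 1)))
    (v : ZMod t) :
    IsLeast
      {x : ℝ | ∃ p : (cycleZMod t).Walk v v,
        (∀ u : ZMod t, u ∈ p.support) ∧ (p.edges.map w).sum = x}
      (min W (2 * (W - M))) := by
  have hw' : ∀ i : ZMod t, 0 ≤ w s(i, i + 1) := fun i => hw _ (cyc_adj ht i)
  have hMle : ∀ i : ZMod t, w s(i, i + 1) ≤ M := fun i => by
    rw [hM]; exact Finset.le_sup' (fun i : ZMod t => w s(i, i + 1)) (Finset.mem_univ i)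
  have hM0 : 0 ≤ M := (hw' 0).trans (hMle 0)
  have hvert : ∀ (a : ZMod t) (u : ZMod t), ∃ k : ℕ, k ≤ t - 1 ∧ u = a + k := fun a u =>
    ⟨(u - a).val, by have := ZMod.val_lt (u - a); omega, by simp⟩
  constructor
  · rcases le_total W (2 * (W - M)) with h | h
    · rw [min_eq_left h]
      obtain ⟨p, hp, hs⟩ := cyc_fwd ht w v t
      refine ⟨p.copy rfl (by simp), ?_, ?_⟩
      · intro u
        obtain ⟨k, hk, rfl⟩ := hvert v u
        simpa using hp k (by omega)
      · simp only [SimpleGraph.Walk.edges_copy]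
        rw [hs, cyc_sum (fun i => w s(i, i + 1)) v, hW]
    · rw [min_eq_right h]
      obtain ⟨j, -, hj⟩ := Finset.exists_mem_eq_sup' Finset.univ_nonempty
        (fun i : ZMod t => w s(i, i + 1))
      rw [← hM] at hj
      obtain ⟨q, hq, hs⟩ := cyc_fwd ht w (j + 1) (t - 1)
      have hsup : ∀ u, u ∈ q.support := fun u => by
        obtain ⟨k, hk, rfl⟩ := hvert (j + 1) u
        exact hq k hk
      have hend : j + 1 + ((t - 1 : ℕ) : ZMod t) = j := by
        rw [Nat.cast_sub (by omega)]; simp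
      have hsum := cyc_sum (fun i => w s(i, i + 1)) (j + 1)
      have hq2 : (q.edges.map w).sum = W - M := by
        have ht1 : t = (t - 1) + 1 := by omega
        have : ∑ k ∈ Finset.range ((t - 1) + 1), w s(j + 1 + (k : ZMod t), j + 1 + k + 1)
            = W := by
          rw [← ht1, hW]; exact hsum
        rw [Finset.sum_range_succ, hend, ← hs, ← hj] at this
        linarith
      have hsplit : ((q.takeUntil v (hsup v)).edges.map w).sum
          + ((q.dropUntil v (hsup v)).edges.map w).sum = (q.edges.map w).sum := by
        conv_rhs => rw [← q.take_spec (hsup v)]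
        simp only [SimpleGraph.Walk.edges_append, List.map_append, List.sum_append]
      refine ⟨((q.takeUntil v (hsup v)).reverse.append q).append
        (q.dropUntil v (hsup v)).reverse, ?_, ?_⟩
      · intro u
        simp [SimpleGraph.Walk.mem_support_append_iff, hsup u]
      · simp only [SimpleGraph.Walk.edges_append, SimpleGraph.Walk.edges_reverse,
          List.map_append, List.sum_append, List.map_reverse, List.sum_reverse]
        linarith
  · rintro x ⟨p, hp, rfl⟩
    rw [cyc_weight ht w p]
    have hpar := cyc_parity_const ht p
    by_cases h0 : (p.edges.count s((0 : ZMod t), 0 + 1) : ZMod 2) = 0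
    · apply (min_le_right _ _).trans
      have hge : ∀ i : ZMod t, p.edges.count s(i, i + 1) ≠ 0 →
          (2 : ℝ) ≤ p.edges.count s(i, i + 1) := by
        intro i hi
        have h1 := hpar i
        rw [h0, ZMod.natCast_eq_zero_iff] at h1
        exact_mod_cast Nat.le_of_dvd (by omega) h1
      by_cases hz : ∃ j : ZMod t, p.edges.count s(j, j + 1) = 0
      · obtain ⟨j, hj⟩ := hz
        have hne : ∀ i, i ≠ j → p.edges.count s(i, i + 1) ≠ 0 := fun i hij hi =>
          hij (cyc_missing ht p hp i j (List.count_eq_zero.mp hi) (List.count_eq_zero.mp hj))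
        have : ∑ i : ZMod t, (2 * w s(i, i + 1) - if i = j then 2 * w s(j, j + 1) else 0) ≤
            ∑ i : ZMod t, (p.edges.count s(i, i + 1) : ℝ) * w s(i, i + 1) := by
          apply Finset.sum_le_sum
          intro i _
          by_cases hij : i = j
          · subst hij; simp [hj]
          · simp only [hij, if_false, sub_zero]
            exact mul_le_mul_of_nonneg_right (hge i (hne i hij)) (hw' i)
        rw [Finset.sum_sub_distrib, ← Finset.mul_sum, ← hW] at this
        simp only [Finset.sum_ite_eq', Finset.mem_univ, if_true] at this
        have := hMle j
        linarith
      · push Not at hz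
        have : ∑ i : ZMod t, 2 * w s(i, i + 1) ≤
            ∑ i : ZMod t, (p.edges.count s(i, i + 1) : ℝ) * w s(i, i + 1) :=
          Finset.sum_le_sum fun i _ => mul_le_mul_of_nonneg_right (hge i (hz i)) (hw' i)
        rw [← Finset.mul_sum, ← hW] at this
        linarith
    · apply (min_le_left _ _).trans
      rw [hW]
      apply Finset.sum_le_sum
      intro i _
      have h1 : p.edges.count s(i, i + 1) ≠ 0 := by
        intro h
        apply h0
        rw [← hpar i, h]; simp
      have h2 : (1 : ℝ) ≤ p.edges.count s(i, i + 1) := by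
        exact_mod_cast Nat.one_le_iff_ne_zero.mpr h1
      exact le_mul_of_one_le_left (hw' i) h2
end
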